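/- Rice's formula for stationary Gaussian processes: Let f be a centered stationary Gaussian process on ℝ with covariance kernel K satisfying K(0) = 1 and K twice differentiable, with almost surely C¹ sample paths, and such that for any pairwise distinct points t₁, …, t_k the joint distribution of (f(t₁), …, f(t_k)) is nondegenerate. Then for every ℓ ∈ ℝ and every bounded interval I of length |I|, the expected number of solutions t ∈ I of f(t) = ℓ equals (|I|/π) √(−K''(0)) e^{−ℓ²/2}. -/

import Mathlib

open MeasureTheory ProbabilityTheory
open scoped ENNReal

/-- `f` is a centered stationary Gaussian process on `ℝ` with covariance kernel `K`,
under the probability measure `P`: every finite linear combination `Σ cᵢ f(tᵢ)` is a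
centered Gaussian random variable with variance `Σᵢⱼ cᵢ cⱼ K(tᵢ − tⱼ)`. -/
def IsStationaryGaussianProcess {Ω : Type*} [MeasurableSpace Ω]
    (f : ℝ → Ω → ℝ) (K : ℝ → ℝ) (P : Measure Ω) : Prop :=
  (∀ t, Measurable (f t)) ∧
  ∀ (k : ℕ) (c : Fin k → ℝ) (t : Fin k → ℝ),
    Measure.map (fun ω => ∑ i, c i * f (t i) ω) P =
      gaussianReal 0 (∑ i, ∑ j, c i * c j * K (t i - t j)).toNNReal

open Filter Topology Set
open scoped NNReal

lemma map_prodMk_eq_prod_gaussianReal {Ω : Type*} [MeasurableSpace Ω] {P : Measure Ω}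
    [IsProbabilityMeasure P] {X Y : Ω → ℝ} (hX : Measurable X) (hY : Measurable Y) {v w : ℝ}
    (hv : 0 ≤ v) (hw : 0 ≤ w)
    (h : ∀ c d : ℝ, P.map (fun ω => c * X ω + d * Y ω) =
      gaussianReal 0 (c ^ 2 * v + d ^ 2 * w).toNNReal) :
    P.map (fun ω => (X ω, Y ω)) = (gaussianReal 0 v.toNNReal).prod (gaussianReal 0 w.toNNReal) := by
  have hXY : Measurable fun ω => (X ω, Y ω) := hX.prodMk hY
  have := Measure.isProbabilityMeasure_map (μ := P) hXY.aemeasurable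
  apply Measure.ext_of_charFunDual
  ext L
  have hL : ∀ ω, L (X ω, Y ω) = L (1, 0) * X ω + L (0, 1) * Y ω := fun ω => by
    have : (X ω, Y ω) = X ω • ((1 : ℝ), (0 : ℝ)) + Y ω • ((0 : ℝ), (1 : ℝ)) := by simp
    rw [this, map_add, map_smul, map_smul]
    simp [mul_comm]
  have h1 : (L.comp (.inl ℝ ℝ ℝ)) 1 = L (1, 0) := by simp
  have h2 : (L.comp (.inr ℝ ℝ ℝ)) 1 = L (0, 1) := by simp
  rw [charFunDual_prod, charFunDual_eq_charFun_map_one, charFunDual_eq_charFun_map_one,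
    charFunDual_eq_charFun_map_one, Measure.map_map (by fun_prop) hXY,
    gaussianReal_map_continuousLinearMap, gaussianReal_map_continuousLinearMap, h1, h2]
  have : (⇑L ∘ fun ω => (X ω, Y ω)) = fun ω => L (1, 0) * X ω + L (0, 1) * Y ω := funext hL
  rw [this, h, charFun_gaussianReal, charFun_gaussianReal, charFun_gaussianReal, ← Complex.exp_add]
  have e1 : (((L (1, 0) ^ 2 * v + L (0, 1) ^ 2 * w).toNNReal : ℝ) : ℂ) =
      ((L (1, 0) ^ 2 * v + L (0, 1) ^ 2 * w : ℝ) : ℂ) := by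
    rw [Real.coe_toNNReal _ (by positivity)]
  congr 1
  rw [e1]
  push_cast
  simp only [Real.coe_toNNReal _ hv, Real.coe_toNNReal _ hw, Real.coe_toNNReal _ (sq_nonneg _),
    (L.comp (.inl ℝ ℝ ℝ)).map_zero, (L.comp (.inr ℝ ℝ ℝ)).map_zero, ← ContinuousLinearMap.coe_comp]
  push_cast
  ring

namespace IsStationaryGaussianProcess

variable {Ω : Type*} [MeasurableSpace Ω] {P : Measure Ω} {f : ℝ → Ω → ℝ} {K : ℝ → ℝ}

lemma map_eq (hf : IsStationaryGaussianProcess f K P) (hK0 : K 0 = 1) (t : ℝ) :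
    P.map (f t) = gaussianReal 0 1 := by
  simpa [hK0] using hf.2 1 (fun _ => 1) (fun _ => t)

lemma map_mean_sub [IsProbabilityMeasure P] (hf : IsStationaryGaussianProcess f K P)
    (hK0 : K 0 = 1) (s t : ℝ)
    (h1 : 0 ≤ 2 + (K (t - s) + K (s - t))) (h2 : 0 ≤ 2 - (K (t - s) + K (s - t))) :
    P.map (fun ω => ((f s ω + f t ω) / 2, f t ω - f s ω)) =
      (gaussianReal 0 ((2 + (K (t - s) + K (s - t))) / 4).toNNReal).prod
        (gaussianReal 0 (2 - (K (t - s) + K (s - t))).toNNReal) := by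
  have ms := hf.1 s
  have mt := hf.1 t
  refine map_prodMk_eq_prod_gaussianReal (by fun_prop) (by fun_prop) (by positivity) h2
    fun c d => ?_
  have := hf.2 2 ![c / 2 - d, c / 2 + d] ![s, t]
  simp only [Fin.sum_univ_two, Matrix.cons_val_zero, Matrix.cons_val_one, sub_self, hK0] at this
  convert this using 3
  · ring
  · ring_nf

lemma add_nonneg_of_posDef (hK0 : K 0 = 1)
    (hnondeg : ∀ (k : ℕ) (t : Fin k → ℝ), Function.Injective t →
      ∀ c : Fin k → ℝ, c ≠ 0 → 0 < ∑ i, ∑ j, c i * c j * K (t i - t j)) (h : ℝ) :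
    0 ≤ 2 + (K h + K (-h)) ∧ 0 ≤ 2 - (K h + K (-h)) := by
  rcases eq_or_ne h 0 with rfl | hh
  · norm_num [hK0]
  have inj : Function.Injective ![h, 0] := by
    intro i j hij
    fin_cases i <;> fin_cases j <;> simp_all
  constructor
  · have := hnondeg 2 ![h, 0] inj ![1, 1] (by simp)
    simp [Fin.sum_univ_two, hK0] at this
    linarith
  · have := hnondeg 2 ![h, 0] inj ![1, -1] (by simp)
    simp [Fin.sum_univ_two, hK0] at this
    linarith

end IsStationaryGaussianProcess

lemma gaussianPDFReal_le_one {v : ℝ≥0} (hv : 1 / 2 ≤ v) (m x : ℝ) : gaussianPDFReal m v x ≤ 1 := by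
  have hv' : (1 / 2 : ℝ) ≤ v := by exact_mod_cast hv
  rw [gaussianPDFReal_def]
  have h1 : 1 ≤ √(2 * Real.pi * v) := by
    rw [Real.one_le_sqrt]
    nlinarith [Real.pi_gt_three]
  have h2 : Real.exp (-(x - m) ^ 2 / (2 * v)) ≤ 1 := by
    rw [Real.exp_le_one_iff, neg_div, neg_nonpos]
    positivity
  exact mul_le_one₀ (inv_le_one_of_one_le₀ h1) (Real.exp_pos _).le h2

lemma gaussianReal_Icc_le (ℓ δ : ℝ) :
    gaussianReal 0 1 (Icc (ℓ - δ) (ℓ + δ)) ≤ ENNReal.ofReal (2 * δ) := by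
  rw [gaussianReal_apply 0 one_ne_zero]
  calc ∫⁻ x in Icc (ℓ - δ) (ℓ + δ), gaussianPDF 0 1 x
      ≤ ∫⁻ x in Icc (ℓ - δ) (ℓ + δ), 1 := by
        refine lintegral_mono fun x => ?_
        rw [gaussianPDF_def]
        exact ENNReal.ofReal_le_one.2 (gaussianPDFReal_le_one (by norm_num) _ _)
    _ = ENNReal.ofReal (2 * δ) := by
        rw [lintegral_one, Measure.restrict_apply_univ, Real.volume_Icc]; congr 1; ring

lemma integral_abs_gaussianReal : ∫ z, |z| ∂(gaussianReal 0 1) = √(2 / Real.pi) := by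
  rw [integral_gaussianReal_eq_integral_smul one_ne_zero]
  have h := integral_comp_abs (f := fun z => gaussianPDFReal 0 1 z * z)
  have h0 : ∀ z, gaussianPDFReal 0 1 |z| = gaussianPDFReal 0 1 z := fun z => by
    simp [gaussianPDFReal_def]
  simp only [h0] at h
  simp only [smul_eq_mul, h]
  have h2 := integral_rpow_mul_exp_neg_mul_rpow (p := 2) (q := 1) (b := 1 / 2) (by norm_num)
    (by norm_num) (by norm_num)
  have h3 : ∀ z : ℝ, gaussianPDFReal 0 1 z * z =
      (√(2 * Real.pi))⁻¹ * (z ^ (1 : ℝ) * Real.exp (-(1 / 2) * z ^ (2 : ℝ))) := fun z => by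
    rw [gaussianPDFReal_def]
    simp
    ring_nf
  simp only [h3, integral_const_mul, h2]
  norm_num
  field_simp
  norm_num

lemma tendsto_second_difference (K : ℝ → ℝ) (hK1 : Differentiable ℝ K)
    (hK2 : Differentiable ℝ (deriv K)) :
    Tendsto (fun h => (2 * K 0 - (K h + K (-h))) / h ^ 2) (𝓝[>] 0) (𝓝 (-deriv (deriv K) 0)) := by
  have hd : ∀ h, HasDerivAt (fun h => 2 * K 0 - (K h + K (-h))) (deriv K (-h) - deriv K h) h := by
    intro h
    have e1 := (hK1 h).hasDerivAt
    have e2 := (hK1 (-h)).hasDerivAt.scomp h (hasDerivAt_neg h)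
    have := (e1.add e2).const_sub (2 * K 0)
    exact this.congr_deriv (by rw [neg_one_smul]; ring)
  refine HasDerivAt.lhopital_zero_nhdsGT (Eventually.of_forall hd)
    (g' := fun h => 2 * h) (Eventually.of_forall fun h => by simpa using hasDerivAt_pow 2 h) ?_ ?_ ?_ ?_
  · filter_upwards [self_mem_nhdsWithin] with h hh
    exact mul_ne_zero two_ne_zero (ne_of_gt hh)
  · have := ((hd 0).continuousAt).tendsto
    simp only [neg_zero] at this
    rw [show 2 * K 0 - (K 0 + K 0) = 0 by ring] at this
    exact this.mono_left nhdsWithin_le_nhds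
  · have : ContinuousAt (fun h : ℝ => h ^ 2) 0 := by fun_prop
    have := this.tendsto
    simp only [ne_eq, OfNat.ofNat_ne_zero, not_false_eq_true, zero_pow] at this
    exact this.mono_left nhdsWithin_le_nhds
  · have e1 := (hK2 0).hasDerivAt
    have e2 : HasDerivAt (fun h => deriv K (-h)) (- deriv (deriv K) 0) 0 := by
      have := (show HasDerivAt (deriv K) _ (-0) from (hK2 (-0)).hasDerivAt).scomp (0 : ℝ)
        (hasDerivAt_neg 0)
      simpa [Function.comp_def] using this
    have := (hasDerivAt_iff_tendsto_slope.1 (e2.sub e1)).mono_left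
      (nhdsWithin_mono (0 : ℝ) (fun x (hx : x ∈ Ioi 0) => ne_of_gt hx))
    have := this.const_mul (1 / 2)
    rw [show (1 / 2 : ℝ) * (-deriv (deriv K) 0 - deriv (deriv K) 0) = -deriv (deriv K) 0 by
      ring] at this
    refine this.congr fun h => ?_
    simp [slope_def_field]
    ring

lemma intervalIntegral_gaussianPDFReal_ball (v : ℝ≥0) (ℓ r : ℝ) :
    ∫ x in (ℓ - r)..(ℓ + r), gaussianPDFReal 0 v x =
      r * ∫ u in (-1 : ℝ)..1, gaussianPDFReal 0 v (ℓ + r * u) := by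
  have := intervalIntegral.mul_integral_comp_add_mul (a := -1) (b := 1)
    (f := gaussianPDFReal 0 v) r ℓ
  rw [this]
  congr 1 <;> ring

lemma continuous_gaussianPDFReal (m : ℝ) (v : ℝ≥0) : Continuous (gaussianPDFReal m v) := by
  rw [gaussianPDFReal_def]
  fun_prop

lemma gaussianReal_ball (v : ℝ≥0) (hv : v ≠ 0) (ℓ r : ℝ) (hr : 0 ≤ r) :
    gaussianReal 0 v {x | |x - ℓ| < r} =
      ENNReal.ofReal (r * ∫ u in (-1 : ℝ)..1, gaussianPDFReal 0 v (ℓ + r * u)) := by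
  have : {x | |x - ℓ| < r} = Ioo (ℓ - r) (ℓ + r) := by
    ext x; simp only [mem_ofPred_eq, mem_Ioo, abs_lt]; constructor <;> rintro ⟨h1, h2⟩ <;>
      constructor <;> linarith
  rw [this, gaussianReal_apply_eq_integral 0 hv, ← integral_Ioc_eq_integral_Ioo,
    ← intervalIntegral.integral_of_le (by linarith), intervalIntegral_gaussianPDFReal_ball]

lemma prod_gaussianReal_crossing (ℓ : ℝ) {v : ℝ≥0} (hv : 1 / 2 ≤ v) {w : ℝ} (hw : 0 ≤ w) :
    (gaussianReal 0 v).prod (gaussianReal 0 w.toNNReal) {p | |p.1 - ℓ| < |p.2| / 2} =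
      ENNReal.ofReal (√w * ∫ z, |z| / 2 * (∫ u in (-1 : ℝ)..1,
      gaussianPDFReal 0 v (ℓ + √w * |z| / 2 * u)) ∂(gaussianReal 0 1)) := by
  have hv0 : v ≠ 0 := by
    rintro rfl
    norm_num at hv
  have hmap : gaussianReal 0 w.toNNReal = (gaussianReal 0 1).map (√w * ·) := by
    rw [gaussianReal_map_const_mul]
    congr 1
    · simp
    · ext
      simp [Real.coe_toNNReal _ hw, Real.sq_sqrt hw]
  have hms : MeasurableSet {p : ℝ × ℝ | |p.1 - ℓ| < |p.2| / 2} :=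
    measurableSet_lt (by fun_prop) (by fun_prop)
  have hcont : Continuous fun z : ℝ => |z| / 2 * (∫ u in (-1 : ℝ)..1,
      gaussianPDFReal 0 v (ℓ + √w * |z| / 2 * u)) := by
    have : Continuous (Function.uncurry fun z u : ℝ =>
        gaussianPDFReal 0 v (ℓ + √w * |z| / 2 * u)) :=
      (continuous_gaussianPDFReal 0 v).comp (by fun_prop)
    exact (by fun_prop : Continuous fun z : ℝ => |z| / 2).mul
      (intervalIntegral.continuous_parametric_intervalIntegral_of_continuous' this _ _)
  have hnn : ∀ z : ℝ, 0 ≤ |z| / 2 * (∫ u in (-1 : ℝ)..1,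
      gaussianPDFReal 0 v (ℓ + √w * |z| / 2 * u)) := fun z =>
    mul_nonneg (by positivity) (intervalIntegral.integral_nonneg (by norm_num)
      fun u _ => gaussianPDFReal_nonneg _ _ _)
  have hint : Integrable (fun z : ℝ => |z| / 2 * (∫ u in (-1 : ℝ)..1,
      gaussianPDFReal 0 v (ℓ + √w * |z| / 2 * u))) (gaussianReal 0 1) := by
    have h1 : Integrable (fun z : ℝ => |z|) (gaussianReal 0 1) :=
      ((memLp_id_gaussianReal 1).integrable le_rfl).abs
    refine h1.mono' hcont.aestronglyMeasurable (Eventually.of_forall fun z => ?_)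
    rw [Real.norm_of_nonneg (hnn z)]
    have : ∫ u in (-1 : ℝ)..1, gaussianPDFReal 0 v (ℓ + √w * |z| / 2 * u) ≤ 2 := by
      have := intervalIntegral.norm_integral_le_of_norm_le_const (a := (-1 : ℝ)) (b := 1) (C := 1)
        (f := fun u => gaussianPDFReal 0 v (ℓ + √w * |z| / 2 * u)) fun u _ => by
          rw [Real.norm_of_nonneg (gaussianPDFReal_nonneg _ _ _)]
          exact gaussianPDFReal_le_one hv _ _
      refine (le_abs_self _).trans (this.trans ?_)
      norm_num
    nlinarith [abs_nonneg z]
  rw [Measure.prod_apply_symm hms, hmap,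
    lintegral_map (measurable_measure_prodMk_right hms) (by fun_prop), ← integral_const_mul,
    ofReal_integral_eq_lintegral_ofReal (hint.const_mul _)
      (Eventually.of_forall fun z => mul_nonneg (Real.sqrt_nonneg _) (hnn z))]
  refine lintegral_congr fun z => ?_
  have := gaussianReal_ball v hv0 ℓ (√w * |z| / 2) (by positivity)
  simp only [preimage_ofPred_eq, abs_mul, abs_of_nonneg (Real.sqrt_nonneg w), this]
  congr 1
  ring

lemma tendsto_crossing_integral {ι : Type*} {l : Filter ι} [l.IsCountablyGenerated]
    {v : ι → ℝ≥0} {w : ι → ℝ} (hv : Tendsto v l (𝓝 1)) (hw : Tendsto w l (𝓝 0)) (ℓ : ℝ) :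
    Tendsto (fun n => ∫ z, |z| / 2 * (∫ u in (-1 : ℝ)..1,
      gaussianPDFReal 0 (v n) (ℓ + √(w n) * |z| / 2 * u)) ∂(gaussianReal 0 1)) l
      (𝓝 (Real.exp (-ℓ ^ 2 / 2) / Real.pi)) := by
  have hv2 : ∀ᶠ n in l, 1 / 2 ≤ v n :=
    hv.eventually (eventually_ge_nhds (by
      rw [← NNReal.coe_lt_coe]; norm_num))
  have hlim : ∀ z u : ℝ, Tendsto (fun n => gaussianPDFReal 0 (v n) (ℓ + √(w n) * |z| / 2 * u)) l
      (𝓝 (gaussianPDFReal 0 1 ℓ)) := by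
    intro z u
    have hx : Tendsto (fun n => ℓ + √(w n) * |z| / 2 * u) l (𝓝 ℓ) := by
      have : Tendsto (fun n => √(w n)) l (𝓝 0) := by simpa using hw.sqrt
      have := (((this.mul_const |z|).div_const 2).mul_const u).const_add ℓ
      simpa using this
    have hv' : Tendsto (fun n => (v n : ℝ)) l (𝓝 1) := by
      simpa using (NNReal.tendsto_coe.2 hv)
    simp only [gaussianPDFReal_def]
    refine Tendsto.mul ?_ ?_
    · refine Tendsto.inv₀ ?_ (by simp [Real.sqrt_ne_zero', Real.pi_pos])
      simpa using (hv'.const_mul (2 * Real.pi)).sqrt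
    · refine (Real.continuous_exp.tendsto _).comp (Tendsto.div ?_ ?_ (by simp))
      · exact ((hx.sub_const 0).pow 2).neg
      · simpa using hv'.const_mul 2
  have hinner : ∀ z : ℝ, Tendsto (fun n => ∫ u in (-1 : ℝ)..1,
      gaussianPDFReal 0 (v n) (ℓ + √(w n) * |z| / 2 * u)) l (𝓝 (2 * gaussianPDFReal 0 1 ℓ)) := by
    intro z
    have : ∫ u in (-1 : ℝ)..1, gaussianPDFReal 0 1 ℓ = 2 * gaussianPDFReal 0 1 ℓ := by
      norm_num
    rw [← this]
    refine intervalIntegral.tendsto_integral_filter_of_dominated_convergence (fun _ => 1)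
      (Eventually.of_forall fun n => ?_) ?_ (by simp) (Eventually.of_forall fun u _ => hlim z u)
    · exact ((continuous_gaussianPDFReal _ _).comp (by fun_prop)).aestronglyMeasurable
    · filter_upwards [hv2] with n hn
      refine Eventually.of_forall fun u _ => ?_
      rw [Real.norm_of_nonneg (gaussianPDFReal_nonneg _ _ _)]
      exact gaussianPDFReal_le_one hn _ _
  have hval : ∫ z, |z| / 2 * (2 * gaussianPDFReal 0 1 ℓ) ∂(gaussianReal 0 1) =
      Real.exp (-ℓ ^ 2 / 2) / Real.pi := by
    rw [integral_mul_const, integral_div, integral_abs_gaussianReal, gaussianPDFReal_def,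
      Real.sqrt_div (by norm_num)]
    simp
    have : √Real.pi * √Real.pi = Real.pi := Real.mul_self_sqrt Real.pi_pos.le
    field_simp
    rw [sq, this]
  rw [← hval]
  refine tendsto_integral_filter_of_dominated_convergence (fun z => |z|) ?_ ?_
    ((memLp_id_gaussianReal 1).integrable le_rfl).abs
    (Eventually.of_forall fun z => (hinner z).const_mul _)
  · refine Eventually.of_forall fun n => Continuous.aestronglyMeasurable ?_
    have : Continuous (Function.uncurry fun z u : ℝ =>
        gaussianPDFReal 0 (v n) (ℓ + √(w n) * |z| / 2 * u)) :=
      (continuous_gaussianPDFReal 0 (v n)).comp (by fun_prop)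
    exact (by fun_prop : Continuous fun z : ℝ => |z| / 2).mul
      (intervalIntegral.continuous_parametric_intervalIntegral_of_continuous' this _ _)
  · filter_upwards [hv2] with n hn
    refine Eventually.of_forall fun z => ?_
    have := intervalIntegral.norm_integral_le_of_norm_le_const (a := (-1 : ℝ)) (b := 1) (C := 1)
      (f := fun u => gaussianPDFReal 0 (v n) (ℓ + √(w n) * |z| / 2 * u)) fun u _ => by
        rw [Real.norm_of_nonneg (gaussianPDFReal_nonneg _ _ _)]
        exact gaussianPDFReal_le_one hn _ _
    rw [norm_mul, Real.norm_of_nonneg (by positivity : 0 ≤ |z| / 2)]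
    norm_num at this
    have h2 : ‖∫ u in (-1 : ℝ)..1, gaussianPDFReal 0 (v n) (ℓ + √(w n) * |z| / 2 * u)‖ ≤ 2 := this
    nlinarith [abs_nonneg z]

open Classical in
/-- The number of sign changes of `g` over the cells of the uniform mesh of `[a, b]` with `n`
cells. -/
noncomputable def signChangeCount (g : ℝ → ℝ) (a b : ℝ) (n : ℕ) : ℕ :=
  (Finset.range n |>.filter fun i : ℕ =>
    g (a + i * ((b - a) / n)) * g (a + (i + 1) * ((b - a) / n)) < 0).card

lemma exists_zero_of_mul_neg {g : ℝ → ℝ} (hg : Continuous g) {x y : ℝ} (hxy : x ≤ y)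
    (h : g x * g y < 0) : ∃ z ∈ Ioo x y, g z = 0 := by
  rcases mul_neg_iff.1 h with ⟨h1, h2⟩ | ⟨h1, h2⟩
  · exact intermediate_value_Ioo' hxy hg.continuousOn ⟨h2, h1⟩
  · exact intermediate_value_Ioo hxy hg.continuousOn ⟨h1, h2⟩

lemma signChangeCount_le_encard {g : ℝ → ℝ} (hg : Continuous g) {a b : ℝ} (hab : a ≤ b) (n : ℕ) :
    (signChangeCount g a b n : ℕ∞) ≤ {t ∈ Icc a b | g t = 0}.encard := by
  classical
  rcases n.eq_zero_or_pos with rfl | hn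
  · simp [signChangeCount]
  have hn' : (0 : ℝ) < n := by exact_mod_cast hn
  set h := (b - a) / n with hh
  have h0 : 0 ≤ h := div_nonneg (sub_nonneg.2 hab) hn'.le
  have hb : a + n * h = b := by rw [hh]; field_simp; ring
  have hz : ∀ i : ℕ, ∃ z, g (a + i * h) * g (a + (i + 1) * h) < 0 →
      z ∈ Ioo (a + i * h) (a + (i + 1) * h) ∧ g z = 0 := fun i => by
    by_cases hi : g (a + i * h) * g (a + (i + 1) * h) < 0
    · obtain ⟨z, hz⟩ := exists_zero_of_mul_neg hg (by nlinarith) hi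
      exact ⟨z, fun _ => hz⟩
    · exact ⟨0, fun h => absurd h hi⟩
  choose z hz using hz
  rw [signChangeCount, ← Set.encard_coe_eq_coe_finsetCard]
  refine Set.encard_le_encard_of_injOn (f := z) ?_ ?_
  · intro i hi
    simp only [Finset.coe_filter, Finset.mem_range, mem_ofPred_eq] at hi
    obtain ⟨⟨h1, h2⟩, h3⟩ := hz i hi.2
    have hi' : (i : ℝ) + 1 ≤ n := by exact_mod_cast hi.1
    refine ⟨⟨?_, ?_⟩, h3⟩
    · have : 0 ≤ (i : ℝ) * h := by positivity
      linarith
    · have : ((i : ℝ) + 1) * h ≤ n * h := by gcongr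
      linarith
  · have key : ∀ i j : ℕ, i < j → g (a + i * h) * g (a + (i + 1) * h) < 0 →
        g (a + j * h) * g (a + (j + 1) * h) < 0 → z i < z j := fun i j hij hi hj => by
      have h1 := (hz i hi).1.2
      have h2 := (hz j hj).1.1
      have hij' : (i : ℝ) + 1 ≤ j := by exact_mod_cast hij
      have : ((i : ℝ) + 1) * h ≤ j * h := by gcongr
      linarith
    intro i hi j hj hij
    simp only [Finset.coe_filter, Finset.mem_range, mem_ofPred_eq] at hi hj
    rcases lt_trichotomy i j with h | h | h
    · exact absurd hij (key i j h hi.2 hj.2).ne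
    · exact h
    · exact absurd hij (key j i h hj.2 hi.2).ne'

lemma exists_sign_change_of_deriv_ne_zero {g : ℝ → ℝ} {z : ℝ} (hz : g z = 0)
    (hd : deriv g z ≠ 0) :
    ∃ ε > 0, ∀ x ∈ Ioo (z - ε) z, ∀ y ∈ Ioo z (z + ε), g x * g y < 0 := by
  have hs := (hasDerivAt_iff_tendsto_slope.1
    (differentiableAt_of_deriv_ne_zero hd).hasDerivAt).mul_const (deriv g z)
  have hpos := hs.eventually (eventually_gt_nhds (mul_self_pos.2 hd))
  rw [eventually_nhdsWithin_iff, Metric.eventually_nhds_iff] at hpos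
  obtain ⟨ε, hε, h⟩ := hpos
  refine ⟨ε, hε, fun x hx y hy => ?_⟩
  have h1 := h (y := x) (by rw [Real.dist_eq, abs_lt]; constructor <;> linarith [hx.1, hx.2])
    hx.2.ne
  have h2 := h (y := y) (by rw [Real.dist_eq, abs_lt]; constructor <;> linarith [hy.1, hy.2])
    hy.1.ne'
  rw [slope_def_field, hz, sub_zero] at h1 h2
  have hx' : x - z < 0 := sub_neg.2 hx.2
  have hy' : 0 < y - z := sub_pos.2 hy.1
  have h3 := mul_pos h1 h2
  have e : g x / (x - z) * deriv g z * (g y / (y - z) * deriv g z) =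
      g x * g y * (deriv g z ^ 2 / ((x - z) * (y - z))) := by
    field_simp
  rw [e] at h3
  have h4 : deriv g z ^ 2 / ((x - z) * (y - z)) < 0 :=
    div_neg_of_pos_of_neg (by positivity) (mul_neg_of_neg_of_pos hx' hy')
  exact neg_of_mul_pos_left h3 h4.le

lemma eventually_card_le_signChangeCount {g : ℝ → ℝ} {a b : ℝ} (hab : a < b)
    (hmesh : ∀ n i : ℕ, 0 < n → g (a + i * ((b - a) / n)) ≠ 0)
    (hd : ∀ t ∈ Icc a b, g t = 0 → deriv g t ≠ 0) (s : Finset ℝ)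
    (hs : ∀ t ∈ s, t ∈ Icc a b ∧ g t = 0) :
    ∀ᶠ n in atTop, s.card ≤ signChangeCount g a b n := by
  classical
  have hlim : Tendsto (fun n : ℕ => (b - a) / n) atTop (𝓝 0) :=
    tendsto_const_nhds.div_atTop tendsto_natCast_atTop_atTop
  have h1 : ∀ᶠ n : ℕ in atTop, ∀ z ∈ s, ∀ x ∈ Ioo (z - 2 * ((b - a) / n)) z,
      ∀ y ∈ Ioo z (z + 2 * ((b - a) / n)), g x * g y < 0 := by
    refine (Filter.eventually_all_finset s).2 fun z hz => ?_
    obtain ⟨ε, hε, h⟩ := exists_sign_change_of_deriv_ne_zero (hs z hz).2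
      (hd z (hs z hz).1 (hs z hz).2)
    filter_upwards [hlim.eventually (eventually_lt_nhds (half_pos hε))] with n hn x hx y hy
    exact h x ⟨by linarith [hx.1], hx.2⟩ y ⟨hy.1, by linarith [hy.2]⟩
  have h2 : ∀ᶠ n : ℕ in atTop, ∀ z ∈ s, ∀ z' ∈ s, z ≠ z' → (b - a) / n < |z - z'| := by
    refine (Filter.eventually_all_finset s).2 fun z _ =>
      (Filter.eventually_all_finset s).2 fun z' _ => ?_
    by_cases hzz : z = z'
    · simp [hzz]
    · filter_upwards [hlim.eventually (eventually_lt_nhds (abs_pos.2 (sub_ne_zero.2 hzz)))]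
        with n hn _ using hn
  filter_upwards [h1, h2, eventually_gt_atTop 0] with n h1 h2 hn
  have hn' : (0 : ℝ) < n := by exact_mod_cast hn
  set h := (b - a) / n with hh
  have h0 : 0 < h := div_pos (sub_pos.2 hab) hn'
  have hb : a + n * h = b := by rw [hh]; field_simp; ring
  have hfl : ∀ z ∈ s, a + ⌊(z - a) / h⌋₊ * h < z ∧ z < a + (⌊(z - a) / h⌋₊ + 1) * h := by
    intro z hz
    have hza : 0 ≤ z - a := sub_nonneg.2 (hs z hz).1.1
    have hle := Nat.floor_le (div_nonneg hza h0.le)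
    have hlt := Nat.lt_floor_add_one ((z - a) / h)
    rw [le_div_iff₀ h0] at hle
    rw [div_lt_iff₀ h0] at hlt
    refine ⟨lt_of_le_of_ne (by linarith) fun he => ?_, by linarith⟩
    apply hmesh n ⌊(z - a) / h⌋₊ hn
    rw [← hh, he]
    exact (hs z hz).2
  refine Finset.card_le_card_of_injOn (fun z => ⌊(z - a) / h⌋₊) ?_ ?_
  · intro z hz
    obtain ⟨hl, hr⟩ := hfl z hz
    simp only [Finset.coe_filter, Finset.mem_range, mem_ofPred_eq]
    refine ⟨?_, h1 z hz _ ⟨by linarith, hl⟩ _ ⟨hr, by linarith⟩⟩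
    have hzb := (hs z hz).1.2
    have : (⌊(z - a) / h⌋₊ : ℝ) < n := by
      by_contra! hc
      have : (n : ℝ) * h ≤ ⌊(z - a) / h⌋₊ * h := by gcongr
      linarith
    exact_mod_cast this
  · intro z hz z' hz' he
    by_contra hne
    have h3 := h2 z hz z' hz' hne
    obtain ⟨hl, hr⟩ := hfl z hz
    obtain ⟨hl', hr'⟩ := hfl z' hz'
    simp only at he
    rw [he] at hl hr
    rcases abs_cases (z - z') with ⟨e, _⟩ | ⟨e, _⟩ <;> rw [e] at h3 <;> linarith

lemma encard_le_liminf_signChangeCount {g : ℝ → ℝ} {a b : ℝ} (hab : a < b)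
    (hmesh : ∀ n i : ℕ, 0 < n → g (a + i * ((b - a) / n)) ≠ 0)
    (hd : ∀ t ∈ Icc a b, g t = 0 → deriv g t ≠ 0) :
    ({t ∈ Icc a b | g t = 0}.encard : ℝ≥0∞) ≤
      liminf (fun n => (signChangeCount g a b n : ℝ≥0∞)) atTop := by
  have key : ∀ s : Finset ℝ, (s : Set ℝ) ⊆ {t ∈ Icc a b | g t = 0} →
      (s.card : ℝ≥0∞) ≤ liminf (fun n => (signChangeCount g a b n : ℝ≥0∞)) atTop := by
    intro s hs
    refine le_liminf_of_le (by isBoundedDefault) ?_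
    filter_upwards [eventually_card_le_signChangeCount hab hmesh hd s fun t ht => hs ht] with n hn
    exact_mod_cast hn
  rcases Set.finite_or_infinite {t ∈ Icc a b | g t = 0} with hfin | hinf
  · rw [hfin.encard_eq_coe_toFinset_card]
    simpa using key hfin.toFinset (by simp)
  · rw [hinf.encard_eq]
    simp only [ENat.toENNReal_top, top_le_iff]
    refine ENNReal.eq_top_of_forall_nnreal_le fun r => ?_
    obtain ⟨k, hk⟩ := exists_nat_ge r
    obtain ⟨s, hs, hc⟩ := hinf.exists_subset_card_eq k
    refine le_trans ?_ (key s hs)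
    rw [hc]
    exact_mod_cast hk

lemma exists_mesh_point_near_critical_zero {g : ℝ → ℝ} (hg : Differentiable ℝ g) {a b ℓ η : ℝ}
    (hab : a < b) (n : ℕ)
    (hη : ∀ x ∈ Icc a b, ∀ y ∈ Icc a b, |x - y| ≤ (b - a) / (n + 1) →
      |deriv g x - deriv g y| ≤ η)
    {t : ℝ} (ht : t ∈ Icc a b) (hgt : g t = ℓ) (hdt : deriv g t = 0) :
    ∃ i ∈ Finset.range (n + 2), g (a + i * ((b - a) / (n + 1))) ∈
      Icc (ℓ - η * ((b - a) / (n + 1))) (ℓ + η * ((b - a) / (n + 1))) := by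
  have hn' : (0 : ℝ) < n + 1 := by positivity
  set h := (b - a) / (n + 1) with hh
  have h0 : 0 < h := div_pos (sub_pos.2 hab) hn'
  have hb : a + (n + 1) * h = b := by rw [hh]; field_simp; ring
  have hta : 0 ≤ t - a := sub_nonneg.2 ht.1
  have hle := Nat.floor_le (div_nonneg hta h0.le)
  have hlt := Nat.lt_floor_add_one ((t - a) / h)
  rw [le_div_iff₀ h0] at hle
  rw [div_lt_iff₀ h0] at hlt
  have hη0 : 0 ≤ η := by simpa using hη t ht t ht (by simpa using h0.le)
  refine ⟨⌊(t - a) / h⌋₊, ?_, ?_⟩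
  · rw [Finset.mem_range]
    have : (⌊(t - a) / h⌋₊ : ℝ) < (n + 2 : ℕ) := by
      push_cast
      by_contra! hc
      have : ((n : ℝ) + 2) * h ≤ ⌊(t - a) / h⌋₊ * h := by gcongr
      linarith [ht.2]
    exact_mod_cast this
  · set x := a + ⌊(t - a) / h⌋₊ * h with hx
    have hax : a ≤ x := by
      have : 0 ≤ (⌊(t - a) / h⌋₊ : ℝ) * h := by positivity
      linarith
    have hxt : x ≤ t := by linarith
    have hmv := (convex_Icc x t).norm_image_sub_le_of_norm_deriv_le (f := g) (C := η)
      (fun y _ => hg y) (fun y hy => by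
        have := hη y ⟨hax.trans hy.1, hy.2.trans ht.2⟩ t ht (by
          rw [abs_le]; constructor <;> linarith [hy.1, hy.2])
        simpa [hdt] using this) (right_mem_Icc.2 hxt) (left_mem_Icc.2 hxt)
    have h3 : ‖x - t‖ ≤ h := by
      rw [Real.norm_eq_abs, abs_le]; constructor <;> linarith
    have h4 := hmv.trans (mul_le_mul_of_nonneg_left h3 hη0)
    rw [hgt, Real.norm_eq_abs, abs_le] at h4
    constructor <;> linarith [h4.1, h4.2]

/-- Bulinskaya's lemma: almost surely, a `C¹` process with standard Gaussian marginals has no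
critical point at level `ℓ`. -/
lemma ae_deriv_ne_zero_of_eq {Ω : Type*} [MeasurableSpace Ω] {P : Measure Ω} {f : ℝ → Ω → ℝ}
    (hm : ∀ t, Measurable (f t)) (hlaw : ∀ t, P.map (f t) = gaussianReal 0 1)
    (hsmooth : ∀ᵐ ω ∂P, ContDiff ℝ 1 (fun t => f t ω)) (ℓ : ℝ) {a b : ℝ} (hab : a < b) :
    ∀ᵐ ω ∂P, ∀ t ∈ Icc a b, f t ω = ℓ → deriv (fun t => f t ω) t ≠ 0 := by
  set A : Set Ω := {ω | ContDiff ℝ 1 (fun t => f t ω) ∧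
    ∃ t ∈ Icc a b, f t ω = ℓ ∧ deriv (fun t => f t ω) t = 0} with hA
  suffices P A = 0 by
    filter_upwards [hsmooth, compl_mem_ae_iff.2 this] with ω h1 h2 t ht h3 h4
    exact h2 ⟨h1, t, ht, h3, h4⟩
  have bound : ∀ η > 0, P A ≤ ENNReal.ofReal (4 * (b - a) * η) := by
    intro η hη
    set B : ℕ → Set Ω := fun n => {ω | ω ∈ A ∧ ∀ x ∈ Icc a b, ∀ y ∈ Icc a b,
      |x - y| ≤ (b - a) / (n + 1) →
        |deriv (fun t => f t ω) x - deriv (fun t => f t ω) y| ≤ η} with hB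
    have hAB : A ⊆ ⋃ n, B n := by
      intro ω hω
      have huc := isCompact_Icc.uniformContinuousOn_of_continuous (s := Icc a b)
        (hω.1.continuous_deriv le_rfl).continuousOn
      rw [Metric.uniformContinuousOn_iff_le] at huc
      obtain ⟨δ, hδ, h⟩ := huc η hη
      have hlim : Tendsto (fun n : ℕ => (b - a) / ((n : ℝ) + 1)) atTop (𝓝 0) :=
        tendsto_const_nhds.div_atTop
          (tendsto_atTop_add_const_right _ _ tendsto_natCast_atTop_atTop)
      obtain ⟨n, hn⟩ := (hlim.eventually (eventually_le_nhds hδ)).exists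
      exact mem_iUnion.2 ⟨n, hω, fun x hx y hy hxy => h x hx y hy (hxy.trans hn)⟩
    have hmono : Monotone B := by
      intro m n hmn ω hω
      refine ⟨hω.1, fun x hx y hy hxy => hω.2 x hx y hy (hxy.trans ?_)⟩
      have : 0 ≤ b - a := sub_nonneg.2 hab.le
      gcongr
    refine (measure_mono hAB).trans ?_
    rw [hmono.measure_iUnion]
    refine iSup_le fun n => ?_
    have h0 : 0 < (b - a) / ((n : ℝ) + 1) := div_pos (sub_pos.2 hab) (by positivity)
    have hsub : B n ⊆ ⋃ i ∈ Finset.range (n + 2), f (a + i * ((b - a) / (n + 1))) ⁻¹'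
        Icc (ℓ - η * ((b - a) / (n + 1))) (ℓ + η * ((b - a) / (n + 1))) := by
      rintro ω ⟨⟨hω, t, ht, h1, h2⟩, h3⟩
      obtain ⟨i, hi, h⟩ := exists_mesh_point_near_critical_zero (hω.differentiable one_ne_zero) hab n
        h3 ht h1 h2
      exact mem_iUnion₂.2 ⟨i, hi, h⟩
    calc P (B n) ≤ ∑ i ∈ Finset.range (n + 2), P (f (a + i * ((b - a) / (n + 1))) ⁻¹'
          Icc (ℓ - η * ((b - a) / (n + 1))) (ℓ + η * ((b - a) / (n + 1)))) :=
        (measure_mono hsub).trans (measure_biUnion_finset_le _ _)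
      _ ≤ ∑ i ∈ Finset.range (n + 2), ENNReal.ofReal (2 * (η * ((b - a) / (n + 1)))) := by
        refine Finset.sum_le_sum fun i _ => ?_
        rw [← Measure.map_apply (hm _) measurableSet_Icc, hlaw]
        exact gaussianReal_Icc_le _ _
      _ = ENNReal.ofReal ((n + 2 : ℕ) * (2 * (η * ((b - a) / (n + 1))))) := by
        rw [Finset.sum_const, Finset.card_range, nsmul_eq_mul, ENNReal.ofReal_mul (Nat.cast_nonneg _),
          ENNReal.ofReal_natCast]
      _ ≤ ENNReal.ofReal (4 * (b - a) * η) := by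
        apply ENNReal.ofReal_le_ofReal
        push_cast
        have h1 : ((n : ℝ) + 1) * ((b - a) / (n + 1)) = b - a := by field_simp
        have h2 : ((n : ℝ) + 2) * ((b - a) / (n + 1)) ≤ 2 * (b - a) := by nlinarith
        nlinarith
  have hlim : Tendsto (fun η : ℝ => ENNReal.ofReal (4 * (b - a) * η)) (𝓝[>] 0) (𝓝 0) := by
    have : Continuous fun η : ℝ => ENNReal.ofReal (4 * (b - a) * η) :=
      ENNReal.continuous_ofReal.comp (by fun_prop)
    have := (this.tendsto 0).mono_left (nhdsWithin_le_nhds (s := Ioi 0))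
    simpa using this
  exact le_antisymm (ge_of_tendsto hlim (eventually_mem_nhdsWithin.mono fun η hη => bound η hη))
    zero_le

namespace IsStationaryGaussianProcess

variable {Ω : Type*} [MeasurableSpace Ω] {P : Measure Ω} {f : ℝ → Ω → ℝ} {K : ℝ → ℝ}

lemma ae_ne (hf : IsStationaryGaussianProcess f K P) (hK0 : K 0 = 1) (t ℓ : ℝ) :
    ∀ᵐ ω ∂P, f t ω ≠ ℓ := by
  have := nullSingletonClass_gaussianReal (μ := 0) (v := 1) one_ne_zero
  have h : gaussianReal 0 1 {ℓ} = 0 := measure_singleton ℓ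
  rw [← hf.map_eq hK0 t, Measure.map_apply (hf.1 t) (measurableSet_singleton ℓ)] at h
  exact compl_mem_ae_iff.2 h

lemma measure_sign_change [IsProbabilityMeasure P] (hf : IsStationaryGaussianProcess f K P)
    (hK0 : K 0 = 1) (ℓ s h : ℝ) (h1 : 0 ≤ K h + K (-h)) (h2 : 0 ≤ 2 - (K h + K (-h))) :
    P {ω | (f s ω - ℓ) * (f (s + h) ω - ℓ) < 0} =
      ENNReal.ofReal (√(2 - (K h + K (-h))) * ∫ z, |z| / 2 * (∫ u in (-1 : ℝ)..1,
        gaussianPDFReal 0 ((2 + (K h + K (-h))) / 4).toNNReal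
          (ℓ + √(2 - (K h + K (-h))) * |z| / 2 * u)) ∂(gaussianReal 0 1)) := by
  have hms : MeasurableSet {p : ℝ × ℝ | |p.1 - ℓ| < |p.2| / 2} :=
    measurableSet_lt (by fun_prop) (by fun_prop)
  have hlaw := hf.map_mean_sub hK0 s (s + h) (by ring_nf at *; linarith) (by ring_nf at *; linarith)
  simp only [add_sub_cancel_left, sub_add_cancel_left] at hlaw
  have ms := hf.1 s
  have mt := hf.1 (s + h)
  rw [← prod_gaussianReal_crossing ℓ _ h2, ← hlaw, Measure.map_apply (by fun_prop) hms]
  · congr 1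
    ext ω
    simp only [mem_ofPred_eq, mem_preimage]
    have e : |f (s + h) ω - f s ω| / 2 = |(f (s + h) ω - f s ω) / 2| := by
      rw [abs_div, abs_two]
    rw [e, ← sq_lt_sq]
    constructor <;> intro h <;> nlinarith
  · rw [← NNReal.coe_le_coe, Real.coe_toNNReal _ (by linarith)]
    push_cast
    linarith

lemma measurableSet_sign_change (hf : IsStationaryGaussianProcess f K P) (ℓ s t : ℝ) :
    MeasurableSet {ω | (f s ω - ℓ) * (f t ω - ℓ) < 0} := by
  have ms := hf.1 s
  have mt := hf.1 t
  exact measurableSet_lt (by fun_prop) (by fun_prop)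

end IsStationaryGaussianProcess

lemma signChangeCount_eq_sum_indicator {Ω : Type*} (f : ℝ → Ω → ℝ) (ℓ a b : ℝ) (n : ℕ) (ω : Ω) :
    (signChangeCount (fun t => f t ω - ℓ) a b n : ℝ≥0∞) = ∑ i ∈ Finset.range n,
      {ω | (f (a + i * ((b - a) / n)) ω - ℓ) *
        (f (a + (i + 1) * ((b - a) / n)) ω - ℓ) < 0}.indicator 1 ω := by
  classical
  rw [signChangeCount, Finset.card_filter]
  push_cast
  refine Finset.sum_congr rfl fun i _ => ?_
  simp [indicator_apply]

namespace IsStationaryGaussianProcess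

variable {Ω : Type*} [MeasurableSpace Ω] {P : Measure Ω} {f : ℝ → Ω → ℝ} {K : ℝ → ℝ}

lemma measurable_signChangeCount (hf : IsStationaryGaussianProcess f K P) (ℓ a b : ℝ) (n : ℕ) :
    Measurable fun ω => (signChangeCount (fun t => f t ω - ℓ) a b n : ℝ≥0∞) := by
  simp only [signChangeCount_eq_sum_indicator]
  exact Finset.measurable_fun_sum _ fun i _ =>
    measurable_one.indicator (hf.measurableSet_sign_change ℓ _ _)

lemma tendsto_lintegral_signChangeCount [IsProbabilityMeasure P]
    (hf : IsStationaryGaussianProcess f K P) (hK0 : K 0 = 1)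
    (hK1 : Differentiable ℝ K) (hK2 : Differentiable ℝ (deriv K))
    (hK : ∀ h, 0 ≤ 2 - (K h + K (-h))) (ℓ : ℝ) {a b : ℝ} (hab : a < b) :
    Tendsto (fun n : ℕ => ∫⁻ ω, (signChangeCount (fun t => f t ω - ℓ) a b n : ℝ≥0∞) ∂P) atTop
      (𝓝 (ENNReal.ofReal ((b - a) / Real.pi * √(-(deriv (deriv K) 0)) *
        Real.exp (-ℓ ^ 2 / 2)))) := by
  set h : ℕ → ℝ := fun n => (b - a) / n with hh
  set r : ℝ → ℝ := fun x => K x + K (-x) with hr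
  have hlim : Tendsto h atTop (𝓝 0) :=
    tendsto_const_nhds.div_atTop tendsto_natCast_atTop_atTop
  have hlim' : Tendsto h atTop (𝓝[>] 0) := by
    refine tendsto_nhdsWithin_iff.2 ⟨hlim, ?_⟩
    filter_upwards [eventually_gt_atTop 0] with n hn
    exact div_pos (sub_pos.2 hab) (by exact_mod_cast hn)
  have hrlim : Tendsto (fun n => r (h n)) atTop (𝓝 2) := by
    have hc : Continuous r := hK1.continuous.add (hK1.continuous.comp continuous_neg)
    have := (hc.tendsto 0).comp hlim
    have e : r 0 = 2 := by simp only [hr, neg_zero, hK0]; norm_num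
    rwa [e] at this
  have hw : Tendsto (fun n => 2 - r (h n)) atTop (𝓝 0) := by
    simpa using hrlim.const_sub 2
  have hv : Tendsto (fun n => ((2 + r (h n)) / 4).toNNReal) atTop (𝓝 1) := by
    have := (hrlim.const_add 2).div_const 4
    norm_num at this
    simpa using tendsto_real_toNNReal this
  have hI := tendsto_crossing_integral hv hw ℓ
  have hσ : Tendsto (fun n => √((2 - r (h n)) / h n ^ 2)) atTop
      (𝓝 √(-(deriv (deriv K) 0))) := by
    have := (tendsto_second_difference K hK1 hK2).comp hlim'
    rw [hK0, mul_one] at this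
    exact this.sqrt
  have hprod := ENNReal.tendsto_ofReal ((hσ.const_mul (b - a)).mul hI)
  have e : (b - a) / Real.pi * √(-(deriv (deriv K) 0)) * Real.exp (-ℓ ^ 2 / 2) =
      (b - a) * √(-(deriv (deriv K) 0)) * (Real.exp (-ℓ ^ 2 / 2) / Real.pi) := by ring
  rw [e]
  refine hprod.congr' ?_
  filter_upwards [eventually_gt_atTop 0, hrlim.eventually (eventually_ge_nhds two_pos)] with n hn hrn
  have hn' : (0 : ℝ) < n := by exact_mod_cast hn
  have hpos : 0 < h n := div_pos (sub_pos.2 hab) hn'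
  simp only [signChangeCount_eq_sum_indicator]
  rw [lintegral_finsetSum _ fun i _ =>
    measurable_one.indicator (hf.measurableSet_sign_change ℓ _ _)]
  have hterm : ∀ i : ℕ, ∫⁻ ω, {ω | (f (a + i * ((b - a) / n)) ω - ℓ) *
        (f (a + (i + 1) * ((b - a) / n)) ω - ℓ) < 0}.indicator 1 ω ∂P = _ := fun i => by
    rw [lintegral_indicator_one (hf.measurableSet_sign_change ℓ _ _),
      show a + ((i : ℝ) + 1) * ((b - a) / n) = a + i * ((b - a) / n) + h n by simp only [hh]; ring,
      hf.measure_sign_change hK0 ℓ _ (h n) hrn (hK _)]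
  rw [Finset.sum_congr rfl fun i _ => hterm i, Finset.sum_const, Finset.card_range, nsmul_eq_mul,
    ← ENNReal.ofReal_natCast, ← ENNReal.ofReal_mul hn'.le]
  congr 1
  rw [Real.sqrt_div (hK _), Real.sqrt_sq hpos.le, ← mul_assoc]
  congr 1
  have : b - a = n * h n := by simp only [hh]; field_simp
  rw [this]
  field_simp

end IsStationaryGaussianProcess

/-- **Rice's formula.** Let `f` be a centered stationary Gaussian process on `ℝ` with
covariance `K`, `K(0) = 1`, `K` twice differentiable, a.s. `C¹` sample paths, and with
nondegenerate finite-dimensional distributions.  Then for every level `ℓ` and every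
bounded interval `I = [a, b]`, the expected number of solutions of `f(t) = ℓ` in `I`
equals `(|I|/π) √(−K''(0)) e^{−ℓ²/2}`. -/
theorem rice_formula
    {Ω : Type*} [MeasurableSpace Ω] (P : Measure Ω) [IsProbabilityMeasure P]
    (f : ℝ → Ω → ℝ) (K : ℝ → ℝ)
    (hfield : IsStationaryGaussianProcess f K P)
    (hK0 : K 0 = 1)
    (hK1 : Differentiable ℝ K) (hK2 : Differentiable ℝ (deriv K))
    (hsmooth : ∀ᵐ ω ∂P, ContDiff ℝ 1 (fun t => f t ω))
    (hnondeg : ∀ (k : ℕ) (t : Fin k → ℝ), Function.Injective t →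
      ∀ c : Fin k → ℝ, c ≠ 0 → 0 < ∑ i, ∑ j, c i * c j * K (t i - t j))
    (ℓ a b : ℝ) (hab : a ≤ b) :
    ∫⁻ ω, (({t ∈ Set.Icc a b | f t ω = ℓ}).encard : ℝ≥0∞) ∂P =
      ENNReal.ofReal ((b - a) / Real.pi * Real.sqrt (-(deriv (deriv K) 0)) *
        Real.exp (-ℓ ^ 2 / 2)) := by
  rcases hab.eq_or_lt with rfl | hab'
  · have : ∀ᵐ ω ∂P, (({t ∈ Set.Icc a a | f t ω = ℓ}).encard : ℝ≥0∞) = 0 := by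
      filter_upwards [hfield.ae_ne hK0 a ℓ] with ω hω
      have : {t ∈ Set.Icc a a | f t ω = ℓ} = ∅ := by
        ext t
        simp only [Icc_self, mem_singleton_iff, mem_ofPred_eq, mem_empty_iff_false, iff_false]
        rintro ⟨rfl, h⟩
        exact hω h
      rw [this]
      simp
    rw [lintegral_congr_ae this]
    simp
  have hset : ∀ ω, {t ∈ Set.Icc a b | f t ω = ℓ} = {t ∈ Set.Icc a b | f t ω - ℓ = 0} := fun ω => by
    simp only [sub_eq_zero]
  have hlim := hfield.tendsto_lintegral_signChangeCount hK0 hK1 hK2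
    (fun h => (IsStationaryGaussianProcess.add_nonneg_of_posDef hK0 hnondeg h).2) ℓ hab'
  have hmesh : ∀ᵐ ω ∂P, ∀ n i : ℕ, f (a + i * ((b - a) / n)) ω ≠ ℓ :=
    ae_all_iff.2 fun n => ae_all_iff.2 fun i => hfield.ae_ne hK0 _ ℓ
  simp only [hset]
  refine le_antisymm ?_ (le_of_tendsto' hlim fun n => lintegral_mono_ae ?_)
  · calc _ ≤ ∫⁻ ω, liminf (fun n => (signChangeCount (fun t => f t ω - ℓ) a b n : ℝ≥0∞)) atTop ∂P := by
          refine lintegral_mono_ae ?_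
          filter_upwards [hmesh, ae_deriv_ne_zero_of_eq hfield.1 (hfield.map_eq hK0) hsmooth ℓ hab']
            with ω h1 h2
          refine encard_le_liminf_signChangeCount hab' (fun n i _ => sub_ne_zero.2 (h1 n i))
            fun t ht h3 => ?_
          rw [deriv_sub_const]
          exact h2 t ht (sub_eq_zero.1 h3)
      _ ≤ liminf (fun n => ∫⁻ ω, (signChangeCount (fun t => f t ω - ℓ) a b n : ℝ≥0∞) ∂P) atTop :=
          lintegral_liminf_le fun n => hfield.measurable_signChangeCount ℓ a b n
      _ = _ := hlim.liminf_eq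
  · filter_upwards [hsmooth] with ω hω
    have := signChangeCount_le_encard (g := fun t => f t ω - ℓ)
      (hω.continuous.sub continuous_const) hab n
    have := ENat.toENNReal_le.2 this
    simpa using this
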